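/- For every η in the closed dominant chamber C̄ and every positive root β ∈ Σ₀⁺ one has 0 ≤ σ_η^k(β∨) ≤ (h_k/n)·η(β∨), where h_k = 2·Σ_{α∈Σ₀} 1/k_α and n = dim V. -/

import Mathlib

open scoped BigOperators
open RealInnerProductSpace

noncomputable section

/-- The coroot `α∨` of a root `α`, under the identification of `V*` with `V`
via the inner product: `ξ(α∨) = 2⟨ξ,α⟩/‖α‖²`. -/
def coroot {V : Type*} [NormedAddCommGroup V] [InnerProductSpace ℝ V] (α : V) : V :=
  (2 / ‖α‖ ^ 2) • α

/-- The orthogonal reflection `s_α` in the hyperplane orthogonal to `α`: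
`s_α(ξ) = ξ − ξ(α∨)·α = ξ − α(ξ)·α∨`. -/
def sRefl {V : Type*} [NormedAddCommGroup V] [InnerProductSpace ℝ V] (α v : V) : V :=
  v - ⟪α, v⟫ • coroot α

/-- A finite, irreducible, reduced, crystallographic root system `Σ₀` in the dual of
the Euclidean space `V` (identified with `V` via the inner product), together with a
fixed base of simple roots, the positive roots, and the highest root. -/
structure RootSystemBase (V : Type*) [NormedAddCommGroup V] [InnerProductSpace ℝ V]
    [FiniteDimensional ℝ V] where
  roots : Finset V
  roots_nonempty : roots.Nonempty
  ne_zero : ∀ α ∈ roots, α ≠ (0 : V)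
  /-- reduced -/
  reduced : ∀ α ∈ roots, ∀ c : ℝ, c • α ∈ roots → c = 1 ∨ c = -1
  /-- crystallographic: `β(α∨) ∈ ℤ` -/
  crystallographic : ∀ α ∈ roots, ∀ β ∈ roots, ∃ m : ℤ, ⟪β, coroot α⟫ = (m : ℝ)
  /-- stable under the reflections `s_α` -/
  refl_mem : ∀ α ∈ roots, ∀ β ∈ roots, sRefl α β ∈ roots
  /-- `Σ₀` spans `V*` -/
  spanning : Submodule.span ℝ (roots : Set V) = ⊤
  /-- irreducible: no nontrivial orthogonal decomposition -/
  irreducible : ∀ s : Finset V, s ⊆ roots →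
    (∀ α ∈ s, ∀ β ∈ roots, β ∉ s → ⟪α, β⟫ = 0) → s = ∅ ∨ s = roots
  /-- the fixed base of simple roots -/
  simples : Finset V
  simples_sub : simples ⊆ roots
  simples_indep : LinearIndependent ℝ (fun β : {x // x ∈ simples} => (β : V))
  /-- the positive roots w.r.t. the base -/
  pos : Finset V
  pos_sub : pos ⊆ roots
  simples_sub_pos : simples ⊆ pos
  pos_or_neg : ∀ α ∈ roots, (α ∈ pos ∧ -α ∉ pos) ∨ (α ∉ pos ∧ -α ∈ pos)
  pos_combo : ∀ α ∈ pos, ∃ c : V → ℝ, (∀ β, 0 ≤ c β) ∧ α = ∑ β ∈ simples, c β • β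
  /-- the highest root `φ` -/
  hroot : V
  hroot_pos : hroot ∈ pos
  hroot_highest : ∀ α ∈ roots, ∃ c : V → ℝ, (∀ β, 0 ≤ c β) ∧
    hroot - α = ∑ β ∈ simples, c β • β

variable {V : Type*} [NormedAddCommGroup V] [InnerProductSpace ℝ V] [FiniteDimensional ℝ V]

/-- The Weyl group `W₀`: the subgroup of linear automorphisms of `V` generated by the
orthogonal reflections in the roots. -/
def weylGroup (R : RootSystemBase V) : Subgroup (V ≃ₗ[ℝ] V) :=
  Subgroup.closure {w : V ≃ₗ[ℝ] V | ∃ α ∈ R.roots, ∀ v, w v = sRefl α v}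

/-- A strictly positive `W₀`-invariant multiplicity function. -/
def IsMultiplicity (R : RootSystemBase V) (k : V → ℝ) : Prop :=
  (∀ α ∈ R.roots, 0 < k α) ∧
  (∀ w : V ≃ₗ[ℝ] V, w ∈ weylGroup R → ∀ α ∈ R.roots, k (w α) = k α)

/-- `σ_η^k = Σ_{α∈Σ₀} arctan(η(α∨)/k_α)·α`. -/
def sigmaFun (R : RootSystemBase V) (k : V → ℝ) (η : V) : V :=
  ∑ α ∈ R.roots, Real.arctan (⟪η, coroot α⟫ / k α) • α

/-- The master function
`S_k(μ,ξ) = ½‖ξ‖² − 2π⟨μ,ξ⟩ + ½ Σ_{α∈Σ₀} ‖α‖² ∫₀^{ξ(α∨)} arctan(t/k_α) dt`. -/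
def masterFun (R : RootSystemBase V) (k : V → ℝ) (μ ξ : V) : ℝ :=
  ‖ξ‖ ^ 2 / 2 - 2 * Real.pi * ⟪μ, ξ⟫ +
    (1 / 2) * ∑ α ∈ R.roots, ‖α‖ ^ 2 * ∫ t in (0:ℝ)..(⟪ξ, coroot α⟫), Real.arctan (t / k α)

/-- Membership in the weight lattice `P = {λ ∈ V* : λ(α∨) ∈ ℤ ∀α ∈ Σ₀}`. -/
def IsWeight (R : RootSystemBase V) (lam : V) : Prop :=
  ∀ α ∈ R.roots, ∃ m : ℤ, ⟪lam, coroot α⟫ = (m : ℝ)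

/-- `η ∈ V*` is a Bethe root: `λ = iη` solves the Bethe ansatz equations
`e^{(wλ)(φ∨)} = ∏_{α∈Σ₀⁺} ((wλ)(α∨) − k_α)/((wλ)(α∨) + k_α))^{α(φ∨)}` for all `w ∈ W₀`,
where `m α = α(φ∨) ∈ ℤ≥0`. -/
def IsBetheRoot (R : RootSystemBase V) (k : V → ℝ) (m : V → ℕ) (η : V) : Prop :=
  ∀ w : V ≃ₗ[ℝ] V, w ∈ weylGroup R →
    Complex.exp (Complex.I * (⟪w η, coroot R.hroot⟫ : ℝ)) =
      ∏ α ∈ R.pos,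
        ((Complex.I * (⟪w η, coroot α⟫ : ℝ) - (k α : ℂ)) /
         (Complex.I * (⟪w η, coroot α⟫ : ℝ) + (k α : ℂ))) ^ (m α)

end

noncomputable section

section Reflection

variable {V : Type*} [NormedAddCommGroup V] [InnerProductSpace ℝ V]

theorem inner_coroot (x α : V) : ⟪x, coroot α⟫ = 2 * ⟪x, α⟫ / ‖α‖ ^ 2 := by
  simp only [coroot, inner_smul_right]
  ring

theorem sRefl_eq_sub_smul (α v : V) : sRefl α v = v - (2 * ⟪α, v⟫ / ‖α‖ ^ 2) • α := by
  simp only [sRefl, coroot, smul_smul]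
  congr 2
  ring

theorem inner_sRefl_left (α x y : V) : ⟪sRefl α x, y⟫ = ⟪x, sRefl α y⟫ := by
  simp only [sRefl_eq_sub_smul, inner_sub_left, inner_sub_right, real_inner_smul_left,
    real_inner_smul_right, real_inner_comm x α]
  ring

theorem sRefl_self {α : V} (hα : α ≠ 0) : sRefl α α = -α := by
  have h : ‖α‖ ^ 2 ≠ 0 := pow_ne_zero 2 (norm_ne_zero_iff.mpr hα)
  rw [sRefl_eq_sub_smul, real_inner_self_eq_norm_sq, mul_div_cancel_right₀ _ h]
  module

/-- The reflection `s_α` as a linear map. -/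
def sReflHom (α : V) : V →ₗ[ℝ] V where
  toFun := sRefl α
  map_add' x y := by
    simp only [sRefl, inner_add_right]
    module
  map_smul' c x := by
    simp only [sRefl, inner_smul_right, RingHom.id_apply]
    module

@[simp]
theorem sReflHom_apply (α v : V) : sReflHom α v = sRefl α v := rfl

theorem sRefl_sRefl {α : V} (hα : α ≠ 0) (v : V) : sRefl α (sRefl α v) = v := by
  have h : sRefl α (sRefl α v) = sRefl α v - (2 * ⟪α, v⟫ / ‖α‖ ^ 2) • sRefl α α := by
    conv_lhs => rw [sRefl_eq_sub_smul α v]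
    simp only [← sReflHom_apply, map_sub, map_smul]
  rw [h, sRefl_self hα, sRefl_eq_sub_smul]
  module

theorem norm_sq_sRefl {α : V} (hα : α ≠ 0) (v : V) : ‖sRefl α v‖ ^ 2 = ‖v‖ ^ 2 := by
  rw [← real_inner_self_eq_norm_sq, inner_sRefl_left, sRefl_sRefl hα, real_inner_self_eq_norm_sq]

theorem inner_coroot_sRefl {β : V} (hβ : β ≠ 0) (x α : V) :
    ⟪x, coroot (sRefl β α)⟫ = ⟪x, coroot α⟫ - ⟪β, coroot α⟫ * ⟪x, coroot β⟫ := by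
  simp only [inner_coroot, norm_sq_sRefl hβ]
  rw [sRefl_eq_sub_smul]
  simp only [inner_sub_right, real_inner_smul_right]
  ring

theorem inner_sRefl_coroot_self {β : V} (hβ : β ≠ 0) (α : V) :
    ⟪sRefl β α, coroot β⟫ = -⟪α, coroot β⟫ := by
  rw [inner_coroot, inner_coroot, inner_sRefl_left, sRefl_self hβ, inner_neg_right]
  ring

end Reflection

section Arctan

theorem arctan_sub_arctan_nonneg_and_le {x y : ℝ} (h : y ≤ x) :
    0 ≤ Real.arctan x - Real.arctan y ∧ Real.arctan x - Real.arctan y ≤ x - y := by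
  refine ⟨sub_nonneg.mpr (Real.arctan_strictMono.monotone h), ?_⟩
  refine image_sub_le_mul_sub_of_deriv_le (f := Real.arctan) (C := 1)
    Real.differentiable_arctan (fun t => ?_) h |>.trans_eq (one_mul _)
  rw [Real.deriv_arctan, div_le_one (by positivity)]
  nlinarith [sq_nonneg t]

theorem arctan_sub_arctan_mul_nonneg_and_le {x y a : ℝ}
    (h : (y ≤ x ∧ 0 ≤ a) ∨ (x ≤ y ∧ a ≤ 0)) :
    0 ≤ (Real.arctan x - Real.arctan y) * a ∧
      (Real.arctan x - Real.arctan y) * a ≤ (x - y) * a := by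
  rcases h with ⟨hxy, ha⟩ | ⟨hxy, ha⟩
  · obtain ⟨h₀, h₁⟩ := arctan_sub_arctan_nonneg_and_le hxy
    exact ⟨mul_nonneg h₀ ha, mul_le_mul_of_nonneg_right h₁ ha⟩
  · obtain ⟨h₀, h₁⟩ := arctan_sub_arctan_nonneg_and_le hxy
    exact ⟨mul_nonneg_of_nonpos_of_nonpos (by linarith) ha,
      mul_le_mul_of_nonpos_right (by linarith) ha⟩

end Arctan

namespace RootSystemBase

variable {V : Type*} [NormedAddCommGroup V] [InnerProductSpace ℝ V] [FiniteDimensional ℝ V]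
  (R : RootSystemBase V)

theorem sum_comp_sRefl {M : Type*} [AddCommMonoid M] {β : V} (hβ : β ∈ R.roots) (f : V → M) :
    ∑ α ∈ R.roots, f (sRefl β α) = ∑ α ∈ R.roots, f α :=
  Finset.sum_nbij' (sRefl β) (sRefl β) (fun α hα => R.refl_mem β hβ α hα)
    (fun α hα => R.refl_mem β hβ α hα) (fun α _ => sRefl_sRefl (R.ne_zero β hβ) α)
    (fun α _ => sRefl_sRefl (R.ne_zero β hβ) α) (fun _ _ => rfl)

variable {R} in
theorem multiplicity_sRefl {k : V → ℝ} (hk : IsMultiplicity R k) {α β : V} (hα : α ∈ R.roots)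
    (hβ : β ∈ R.roots) : k (sRefl β α) = k α :=
  hk.2 (LinearEquiv.ofInvolutive (sReflHom β) (sRefl_sRefl (R.ne_zero β hβ)))
    (Subgroup.subset_closure ⟨β, hβ, fun _ => rfl⟩) α hα

/-- The frame operator `ξ ↦ Σ_α w_α ⟨α,ξ⟩ α` of the roots with weights `w`. -/
def frameOp (w : V → ℝ) : V →ₗ[ℝ] V :=
  ∑ α ∈ R.roots, w α • (innerₛₗ ℝ α).smulRight α

theorem frameOp_apply (w : V → ℝ) (ξ : V) :
    R.frameOp w ξ = ∑ α ∈ R.roots, (w α * ⟪α, ξ⟫) • α := by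
  simp [frameOp, LinearMap.sum_apply, smul_smul]

theorem inner_frameOp (w : V → ℝ) (ξ ζ : V) :
    ⟪R.frameOp w ξ, ζ⟫ = ∑ α ∈ R.roots, w α * ⟪α, ξ⟫ * ⟪α, ζ⟫ := by
  simp [frameOp_apply, sum_inner, real_inner_smul_left]

theorem inner_frameOp_comm (w : V → ℝ) (ξ ζ : V) :
    ⟪R.frameOp w ξ, ζ⟫ = ⟪ξ, R.frameOp w ζ⟫ := by
  rw [real_inner_comm (R.frameOp w ζ) ξ, inner_frameOp, inner_frameOp]
  exact Finset.sum_congr rfl fun α _ => by ring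

variable {R} {w : V → ℝ}

theorem sRefl_frameOp
    (hw : ∀ β ∈ R.roots, ∀ α ∈ R.roots, w (sRefl β α) = w α)
    {β : V} (hβ : β ∈ R.roots) (ξ : V) :
    sRefl β (R.frameOp w ξ) = R.frameOp w (sRefl β ξ) := by
  rw [frameOp_apply, frameOp_apply, ← R.sum_comp_sRefl hβ, ← sReflHom_apply, map_sum]
  refine Finset.sum_congr rfl fun α hα => ?_
  rw [hw β hβ α hα, inner_sRefl_left, map_smul, sReflHom_apply, sRefl_sRefl (R.ne_zero β hβ)]

theorem exists_frameOp_root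
    (hw : ∀ β ∈ R.roots, ∀ α ∈ R.roots, w (sRefl β α) = w α)
    {β : V} (hβ : β ∈ R.roots) :
    ∃ c : ℝ, R.frameOp w β = c • β := by
  have h := sRefl_frameOp hw hβ β
  rw [sRefl_self (R.ne_zero β hβ), map_neg, sRefl_eq_sub_smul] at h
  refine ⟨⟪β, R.frameOp w β⟫ / ‖β‖ ^ 2, ?_⟩
  have h₂ : (2 : ℝ) • R.frameOp w β = (2 * ⟪β, R.frameOp w β⟫ / ‖β‖ ^ 2) • β := by
    rw [two_smul]
    linear_combination (norm := module) h
  rw [mul_div_assoc, mul_smul] at h₂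
  exact smul_right_injective V two_ne_zero h₂

theorem exists_frameOp_eq_smul
    (hw : ∀ β ∈ R.roots, ∀ α ∈ R.roots, w (sRefl β α) = w α)
    : ∃ c : ℝ, ∀ ξ, R.frameOp w ξ = c • ξ := by
  classical
  obtain ⟨γ, hγ⟩ := R.roots_nonempty
  obtain ⟨c, hc⟩ := exists_frameOp_root hw hγ
  refine ⟨c, ?_⟩
  have hs : R.roots.filter (fun α => R.frameOp w α = c • α) = R.roots := by
    refine (R.irreducible _ (Finset.filter_subset _ _) fun α hα β hβ hβs => ?_).resolve_left
      (Finset.nonempty_iff_ne_empty.mp ⟨γ, Finset.mem_filter.mpr ⟨hγ, hc⟩⟩)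
    obtain ⟨d, hd⟩ := exists_frameOp_root hw hβ
    have hdc : c - d ≠ 0 := by
      intro h
      exact hβs (Finset.mem_filter.mpr ⟨hβ, by rw [hd, sub_eq_zero.mp h]⟩)
    have h := R.inner_frameOp_comm w α β
    rw [(Finset.mem_filter.mp hα).2, hd, real_inner_smul_left, real_inner_smul_right] at h
    exact (mul_eq_zero.mp (by linear_combination h : (c - d) * ⟪α, β⟫ = 0)).resolve_left hdc
  have hext : R.frameOp w = c • LinearMap.id :=
    LinearMap.ext_on R.spanning fun α hα => by
      rw [Finset.mem_coe, ← hs] at hα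
      simpa using (Finset.mem_filter.mp hα).2
  intro ξ
  simp [hext]

theorem finrank_mul_sum_inner_sq
    (hw : ∀ β ∈ R.roots, ∀ α ∈ R.roots, w (sRefl β α) = w α)
    (ξ : V) :
    (Module.finrank ℝ V : ℝ) * ∑ α ∈ R.roots, w α * ⟪α, ξ⟫ ^ 2 =
      (∑ α ∈ R.roots, w α * ‖α‖ ^ 2) * ‖ξ‖ ^ 2 := by
  obtain ⟨c, hc⟩ := exists_frameOp_eq_smul hw
  have hquad (ζ : V) : ∑ α ∈ R.roots, w α * ⟪α, ζ⟫ ^ 2 = c * ‖ζ‖ ^ 2 := by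
    rw [← real_inner_self_eq_norm_sq, ← real_inner_smul_left, ← hc, inner_frameOp]
    exact Finset.sum_congr rfl fun α _ => by ring
  have htrace : ∑ α ∈ R.roots, w α * ‖α‖ ^ 2 = Module.finrank ℝ V * c := by
    let e := stdOrthonormalBasis ℝ V
    calc
      ∑ α ∈ R.roots, w α * ‖α‖ ^ 2
          = ∑ α ∈ R.roots, ∑ i, w α * ⟪α, e i⟫ ^ 2 := by
            refine Finset.sum_congr rfl fun α _ => ?_
            rw [← Finset.mul_sum, ← e.sum_sq_inner_left α]
      _ = ∑ i, ∑ α ∈ R.roots, w α * ⟪α, e i⟫ ^ 2 := Finset.sum_comm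
      _ = Module.finrank ℝ V * c := by simp [hquad]
  rw [hquad, htrace]
  ring

end RootSystemBase

theorem two_mul_inner_sigmaFun_coroot {V : Type*} [NormedAddCommGroup V]
    [InnerProductSpace ℝ V] [FiniteDimensional ℝ V] {R : RootSystemBase V} {k : V → ℝ}
    (hk : IsMultiplicity R k) (η : V) {β : V} (hβ : β ∈ R.roots) :
    2 * ⟪sigmaFun R k η, coroot β⟫ =
      ∑ α ∈ R.roots, (Real.arctan (⟪η, coroot α⟫ / k α) -
        Real.arctan (⟪η, coroot (sRefl β α)⟫ / k α)) * ⟪α, coroot β⟫ := by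
  have h : ⟪sigmaFun R k η, coroot β⟫ =
      ∑ α ∈ R.roots, Real.arctan (⟪η, coroot α⟫ / k α) * ⟪α, coroot β⟫ := by
    simp [sigmaFun, sum_inner, real_inner_smul_left]
  have h' := h
  rw [← R.sum_comp_sRefl hβ] at h'
  rw [two_mul]
  nth_rewrite 1 [h]
  rw [h', ← Finset.sum_add_distrib]
  refine Finset.sum_congr rfl fun α hα => ?_
  rw [RootSystemBase.multiplicity_sRefl hk hα hβ, inner_sRefl_coroot_self (R.ne_zero β hβ)]
  ring

/-- For `η` in the closed dominant chamber and `β ∈ Σ₀⁺`: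
`0 ≤ σ_η^k(β∨) ≤ (h_k/n)·η(β∨)` with `h_k = 2 Σ_{α∈Σ₀} 1/k_α` and `n = dim V`. -/
theorem statement5
    {V : Type*} [NormedAddCommGroup V] [InnerProductSpace ℝ V] [FiniteDimensional ℝ V]
    (R : RootSystemBase V) (k : V → ℝ) (hk : IsMultiplicity R k)
    (η : V) (hη : ∀ α ∈ R.pos, 0 ≤ ⟪η, coroot α⟫)
    (β : V) (hβ : β ∈ R.pos) :
    0 ≤ ⟪sigmaFun R k η, coroot β⟫ ∧
    ⟪sigmaFun R k η, coroot β⟫ ≤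
      ((2 * ∑ α ∈ R.roots, (k α)⁻¹) / (Module.finrank ℝ V : ℝ)) * ⟪η, coroot β⟫ := by
  have hβr := R.pos_sub hβ
  have hβ0 := R.ne_zero β hβr
  have hβn : 0 < ‖β‖ ^ 2 := pow_pos (norm_pos_iff.mpr hβ0) 2
  have hηβ := hη β hβ
  have hsum := two_mul_inner_sigmaFun_coroot hk η hβr
  have hterm (α : V) (hα : α ∈ R.roots) := by
    have hk₀ := hk.1 α hα
    have hαn : 0 < ‖α‖ ^ 2 := pow_pos (norm_pos_iff.mpr (R.ne_zero α hα)) 2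
    refine arctan_sub_arctan_mul_nonneg_and_le (x := ⟪η, coroot α⟫ / k α)
      (y := ⟪η, coroot (sRefl β α)⟫ / k α) (a := ⟪α, coroot β⟫) ?_
    rw [inner_coroot_sRefl hβ0, div_le_div_iff_of_pos_right hk₀,
      div_le_div_iff_of_pos_right hk₀, sub_le_self_iff, le_sub_self_iff, inner_coroot β α,
      inner_coroot α β, real_inner_comm α β]
    rcases le_total 0 ⟪α, β⟫ with h | h
    · exact Or.inl ⟨mul_nonneg (by positivity) hηβ, by positivity⟩
    · have h₂ : 2 * ⟪α, β⟫ ≤ 0 := by linarith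
      exact Or.inr ⟨mul_nonpos_of_nonpos_of_nonneg (div_nonpos_of_nonpos_of_nonneg h₂ hαn.le) hηβ,
        div_nonpos_of_nonpos_of_nonneg h₂ hβn.le⟩
  have hlow := Finset.sum_nonneg fun α hα => (hterm α hα).1
  have hup := Finset.sum_le_sum fun α hα => (hterm α hα).2
  rw [← hsum] at hlow hup
  refine ⟨by linarith, ?_⟩
  have hw : ∀ γ ∈ R.roots, ∀ α ∈ R.roots,
      (fun α => (k α)⁻¹ / ‖α‖ ^ 2) (sRefl γ α) = (fun α => (k α)⁻¹ / ‖α‖ ^ 2) α :=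
    fun γ hγ α hα => by
      simp only [RootSystemBase.multiplicity_sRefl hk hα hγ, norm_sq_sRefl (R.ne_zero γ hγ)]
  have hframe := RootSystemBase.finrank_mul_sum_inner_sq (w := fun α => (k α)⁻¹ / ‖α‖ ^ 2) hw β
  have hmass : ∑ α ∈ R.roots, (k α)⁻¹ / ‖α‖ ^ 2 * ‖α‖ ^ 2 = ∑ α ∈ R.roots, (k α)⁻¹ :=
    Finset.sum_congr rfl fun α hα =>
      div_mul_cancel₀ _ (pow_ne_zero 2 (norm_ne_zero_iff.mpr (R.ne_zero α hα)))
  rw [hmass] at hframe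
  have : Nontrivial V := ⟨β, 0, hβ0⟩
  have hn : (0 : ℝ) < Module.finrank ℝ V := Nat.cast_pos.mpr Module.finrank_pos
  have heq : ∑ α ∈ R.roots, (⟪η, coroot α⟫ / k α - ⟪η, coroot (sRefl β α)⟫ / k α) *
      ⟪α, coroot β⟫ =
      4 * ⟪η, coroot β⟫ / ‖β‖ ^ 2 * ∑ α ∈ R.roots, (k α)⁻¹ / ‖α‖ ^ 2 * ⟪α, β⟫ ^ 2 := by
    rw [Finset.mul_sum]
    refine Finset.sum_congr rfl fun α _ => ?_
    rw [inner_coroot_sRefl hβ0, inner_coroot β α, inner_coroot α β, real_inner_comm α β]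
    ring
  rw [heq, eq_div_of_mul_eq hn.ne' ((mul_comm _ _).trans hframe)] at hup
  have hfin : 4 * ⟪η, coroot β⟫ / ‖β‖ ^ 2 *
      ((∑ α ∈ R.roots, (k α)⁻¹) * ‖β‖ ^ 2 / (Module.finrank ℝ V : ℝ)) =
      2 * ((2 * ∑ α ∈ R.roots, (k α)⁻¹) / (Module.finrank ℝ V : ℝ) * ⟪η, coroot β⟫) := by
    field_simp
    ring
  linarith

end
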